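/- Let R_1, …, R_p be incommensurate cocompact lattices in R^d and let Γ_j = R^d / R_j carry the normalized Haar probability measure. Then for every continuous function f : Γ_2 × ⋯ × Γ_p → C and every point (γ_2, …, γ_p) ∈ Γ_2 × ⋯ × Γ_p, the discrete Birkhoff averages over lattice sites of R_1 converge: (1/#(R_1 ∩ B_r)) · Σ_{n ∈ R_1 ∩ B_r} f(γ_2 − n, …, γ_p − n) → ∫_{Γ_2 × ⋯ × Γ_p} f as r → ∞, where the integral is with respect to the product of the normalized Haar measures; that is, the R_1-orbit of any point equidistributes in Γ_2 × ⋯ × Γ_p. -/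

import Mathlib

open scoped RealInnerProductSpace
open Filter MeasureTheory

/-- The cocompact lattice `R = E·ℤ^d` in `ℝ^d`. -/
noncomputable def latticeSet {d : ℕ} (E : Matrix (Fin d) (Fin d) ℝ) :
    Set (EuclideanSpace ℝ (Fin d)) :=
  Set.range fun m : Fin d → ℤ =>
    (EuclideanSpace.equiv (Fin d) ℝ).symm (E.mulVec fun j => (m j : ℝ))

/-- The dual lattice `R* = {k : k·n ∈ ℤ for all n ∈ R}`. -/
noncomputable def dualLattice {d : ℕ} (E : Matrix (Fin d) (Fin d) ℝ) :
    Set (EuclideanSpace ℝ (Fin d)) :=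
  {k | ∀ n ∈ latticeSet E, ∃ z : ℤ, ⟪k, n⟫ = (z : ℝ)}

/-- The lattice `R` as an additive subgroup of `ℝ^d` (the set `latticeSet E` is already closed
under the group operations, so the closure adds nothing). -/
noncomputable def latticeGroup {d : ℕ} (E : Matrix (Fin d) (Fin d) ℝ) :
    AddSubgroup (EuclideanSpace ℝ (Fin d)) :=
  AddSubgroup.closure (latticeSet E)

/-- The quotient torus `Γ = ℝ^d / R`. -/
abbrev QuotTorus {d : ℕ} (E : Matrix (Fin d) (Fin d) ℝ) : Type :=
  EuclideanSpace ℝ (Fin d) ⧸ latticeGroup E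

/-- The fundamental cell `Γ̂ = E·[−1/2, 1/2)^d`. -/
noncomputable def fundamentalCell {d : ℕ} (E : Matrix (Fin d) (Fin d) ℝ) :
    Set (EuclideanSpace ℝ (Fin d)) :=
  Set.image (fun t : Fin d → ℝ => (EuclideanSpace.equiv (Fin d) ℝ).symm (E.mulVec t))
    {t | ∀ i, t i ∈ Set.Ico (-(1/2) : ℝ) (1/2)}

/-- The Haar measure on `ℝ^d / R` normalized to total mass `|Γ| = |det E|`, i.e., the
pushforward of the Lebesgue measure on the fundamental cell by the quotient map. -/
noncomputable def haarCell {d : ℕ} (E : Matrix (Fin d) (Fin d) ℝ) : Measure (QuotTorus E) :=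
  Measure.map QuotientAddGroup.mk (volume.restrict (fundamentalCell E))

/-- The normalized Haar probability measure on the quotient torus `ℝ^d / R`. -/
noncomputable def haarProb {d : ℕ} (E : Matrix (Fin d) (Fin d) ℝ) : Measure (QuotTorus E) :=
  (ENNReal.ofReal |E.det|)⁻¹ • haarCell E

/-- The hull `Ω = Γ_1 × ⋯ × Γ_p`. -/
abbrev Hull {d p : ℕ} (E : Fin p → Matrix (Fin d) (Fin d) ℝ) : Type :=
  (j : Fin p) → QuotTorus (E j)

/-- The normalized Haar product probability measure `P` on `Ω`. -/
noncomputable def hullProb {d p : ℕ} (E : Fin p → Matrix (Fin d) (Fin d) ℝ) :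
    Measure (Hull E) :=
  Measure.pi fun j => haarProb (E j)

/-- The diagonal translation `T_a(γ_1, …, γ_p) = (γ_1 + a, …, γ_p + a)` on `Ω`. -/
noncomputable def diagT {d p : ℕ} (E : Fin p → Matrix (Fin d) (Fin d) ℝ)
    (a : EuclideanSpace ℝ (Fin d)) : Hull E → Hull E :=
  fun ω j => ω j + QuotientAddGroup.mk a

/-- The lattices `R_1, …, R_p` are incommensurate: a tuple of dual vectors sums to zero only
if all of them vanish. -/
def Incommensurate {d p : ℕ} (E : Fin p → Matrix (Fin d) (Fin d) ℝ) : Prop :=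
  ∀ k : Fin p → EuclideanSpace ℝ (Fin d), (∀ j, k j ∈ dualLattice (E j)) →
    ((∑ j, k j) = 0 ↔ ∀ j, k j = 0)


open scoped Matrix

lemma quot_meas {d : ℕ} (E : Matrix (Fin d) (Fin d) ℝ) :
    OpensMeasurableSpace (QuotTorus E) := by
  constructor
  refine MeasurableSpace.generateFrom_le ?_
  intro s hs
  have hs : IsOpen s := hs
  have h2 : IsOpen ((QuotientAddGroup.mk : _ → QuotTorus E) ⁻¹' s) := hs.preimage continuous_quot_mk
  exact h2.measurableSet


/-- the linear parametrization -/
noncomputable def par {d : ℕ} (E : Matrix (Fin d) (Fin d) ℝ) (t : Fin d → ℝ) :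
    EuclideanSpace ℝ (Fin d) := (EuclideanSpace.equiv (Fin d) ℝ).symm (E.mulVec t)

lemma par_cont {d : ℕ} (E : Matrix (Fin d) (Fin d) ℝ) : Continuous (par E) := by
  unfold par
  fun_prop

lemma par_add {d : ℕ} (E : Matrix (Fin d) (Fin d) ℝ) (s t : Fin d → ℝ) :
    par E (s + t) = par E s + par E t := by
  simp [par, Matrix.mulVec_add]

lemma par_neg {d : ℕ} (E : Matrix (Fin d) (Fin d) ℝ) (s : Fin d → ℝ) :
    par E (-s) = -par E s := by
  simp [par, Matrix.mulVec_neg]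

lemma par_inv {d : ℕ} (E : Matrix (Fin d) (Fin d) ℝ) (hE : IsUnit E.det) (s : EuclideanSpace ℝ (Fin d)) :
    par E (E⁻¹ *ᵥ s) = s := by
  ext i
  simp [par, Matrix.mul_nonsing_inv _ hE]

lemma inv_par {d : ℕ} (E : Matrix (Fin d) (Fin d) ℝ) (hE : IsUnit E.det) (s : Fin d → ℝ) :
    (E⁻¹ *ᵥ (par E s)) = s := by
  simp [par, Matrix.nonsing_inv_mul _ hE]

lemma par_inj {d : ℕ} (E : Matrix (Fin d) (Fin d) ℝ) (hE : IsUnit E.det) :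
    Function.Injective (par E) := by
  intro s t h
  rw [← inv_par E hE s, ← inv_par E hE t, h]

lemma latticeGroup_coe {d : ℕ} (E : Matrix (Fin d) (Fin d) ℝ) :
    (latticeGroup E : Set _) = latticeSet E := by
  let G : AddSubgroup (EuclideanSpace ℝ (Fin d)) :=
    { carrier := latticeSet E
      add_mem' := by
        rintro _ _ ⟨m, rfl⟩ ⟨n, rfl⟩
        refine ⟨m + n, ?_⟩
        have := par_add E (fun j => (m j : ℝ)) (fun j => (n j : ℝ))
        refine Eq.trans ?_ this
        refine congrArg (par E) ?_
        ext j
        simp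
      zero_mem' := ⟨0, by
        ext i
        simp [Matrix.mulVec, dotProduct]⟩
      neg_mem' := by
        rintro _ ⟨m, rfl⟩
        refine ⟨-m, ?_⟩
        have := par_neg E (fun j => (m j : ℝ))
        refine Eq.trans ?_ this
        refine congrArg (par E) ?_
        ext j
        simp }
  exact congrArg _ (AddSubgroup.closure_eq G)

lemma mem_latticeGroup {d : ℕ} (E : Matrix (Fin d) (Fin d) ℝ) (x) :
    x ∈ latticeGroup E ↔ x ∈ latticeSet E := by
  rw [← latticeGroup_coe]; rfl

/-- the cube -/
def cube (d : ℕ) : Set (Fin d → ℝ) := Set.univ.pi fun _ => Set.Ico (-(1/2) : ℝ) (1/2)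

lemma cell_eq {d : ℕ} (E : Matrix (Fin d) (Fin d) ℝ) : fundamentalCell E = par E '' cube d := by
  unfold fundamentalCell cube par
  congr 1
  ext t
  simp

lemma map_par {d : ℕ} (E : Matrix (Fin d) (Fin d) ℝ) (hE : IsUnit E.det) :
    Measure.map (par E) volume = (ENNReal.ofReal |E.det|)⁻¹ • volume := by
  have h1 := Real.map_matrix_volume_pi_eq_smul_volume_pi hE.ne_zero
  have h2 := (PiLp.volume_preserving_toLp (Fin d)).map_eq
  have : par E = (WithLp.toLp 2) ∘ (Matrix.toLin' E) := by
    ext t i; simp [par]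
  rw [this, ← Measure.map_map, h1, Measure.map_smul, h2, abs_inv, ENNReal.ofReal_inv_of_pos (abs_pos.2 hE.ne_zero)]
  · exact (PiLp.volume_preserving_toLp (Fin d)).measurable
  · exact (Matrix.toLin' E).continuous_of_finiteDimensional.measurable

/-- the closed embedding -/
lemma par_emb {d : ℕ} (E : Matrix (Fin d) (Fin d) ℝ) (hE : IsUnit E.det) :
    MeasurableEmbedding (par E) :=
  (par_cont E).measurableEmbedding (par_inj E hE)

lemma haarProb_eq {d : ℕ} (E : Matrix (Fin d) (Fin d) ℝ) (hE : IsUnit E.det) :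
    haarProb E = Measure.map (fun t => (QuotientAddGroup.mk (par E t) : QuotTorus E))
      (volume.restrict (cube d)) := by
  have hm : Measurable (QuotientAddGroup.mk : _ → QuotTorus E) := measurable_quotient_mk''
  rw [haarProb, haarCell, cell_eq, ← Measure.map_smul, ← Measure.restrict_smul, ← map_par E hE,
    (par_emb E hE).restrict_map, Set.preimage_image_eq _ (par_inj E hE), Measure.map_map hm (par_emb E hE).measurable]
  rfl

instance cube_prob (d : ℕ) : IsProbabilityMeasure ((volume : Measure (Fin d → ℝ)).restrict (cube d)) := by
  constructor
  rw [Measure.restrict_apply_univ, cube, Real.volume_pi_Ico]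
  norm_num

lemma par_mk_meas {d : ℕ} (E : Matrix (Fin d) (Fin d) ℝ) :
    Measurable (fun t => (QuotientAddGroup.mk (par E t) : QuotTorus E)) :=
  measurable_quotient_mk''.comp (par_cont E).measurable

lemma haarProb_prob {d : ℕ} (E : Matrix (Fin d) (Fin d) ℝ) (hE : IsUnit E.det) :
    IsProbabilityMeasure (haarProb E) := by
  rw [haarProb_eq E hE]
  exact Measure.isProbabilityMeasure_map (par_mk_meas E).aemeasurable

lemma int_mulexp (m : ℤ) : ∫ t in Set.Ico (-(1/2) : ℝ) (1/2), Complex.exp (2 * Real.pi * Complex.I * m * t)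
    = if m = 0 then 1 else 0 := by
  rw [integral_Ico_eq_integral_Ioc, ← intervalIntegral.integral_of_le (by norm_num)]
  split_ifs with h
  · simp [h]; norm_num
  · have hm : (2 * Real.pi * Complex.I * m : ℂ) ≠ 0 := by
      simp [h, Real.pi_ne_zero]
    rw [integral_exp_mul_complex hm, div_eq_zero_iff]
    left
    rw [sub_eq_zero, Complex.exp_eq_exp_iff_exists_int]
    refine ⟨m, ?_⟩
    push_cast
    ring

lemma int_cube {d : ℕ} (m : Fin d → ℤ) :
    ∫ t in cube d, Complex.exp (2 * Real.pi * Complex.I * ∑ i, (m i * t i : ℂ))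
    = if m = 0 then 1 else 0 := by
  rw [cube, volume_pi, Measure.restrict_pi_pi]
  have : ∀ t : Fin d → ℝ, Complex.exp (2 * Real.pi * Complex.I * ∑ i, (m i * t i : ℂ))
     = ∏ i, Complex.exp (2 * Real.pi * Complex.I * m i * t i) := by
    intro t
    rw [← Complex.exp_sum, Finset.mul_sum]
    congr 1
    exact Finset.sum_congr rfl fun i _ => by ring
  simp_rw [this]
  rw [integral_fintype_prod_eq_prod (fun i (x : ℝ) => Complex.exp (2 * Real.pi * Complex.I * m i * x))]
  simp_rw [int_mulexp]
  split_ifs with h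
  · simp [h]
  · obtain ⟨i, hi⟩ := Function.ne_iff.1 h
    exact Finset.prod_eq_zero (Finset.mem_univ i) (by simpa using hi)

lemma dual_par {d : ℕ} (E : Matrix (Fin d) (Fin d) ℝ) (hE : IsUnit E.det)
    (k : EuclideanSpace ℝ (Fin d)) (hk : k ∈ dualLattice E) :
    ∃ m : Fin d → ℤ, (∀ t : Fin d → ℝ, ⟪k, par E t⟫ = ∑ i, m i * t i) ∧ (m = 0 → k = 0) := by
  have h1 : ∀ i, ∃ z : ℤ, ⟪k, par E (Pi.single i 1)⟫ = (z : ℝ) := by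
    intro i
    apply hk
    refine ⟨Pi.single i 1, ?_⟩
    refine congrArg (par E) ?_
    ext j
    by_cases h : j = i
    · subst h; simp
    · simp [h]
  choose m hm using h1
  have h2 : ∀ t : Fin d → ℝ, ⟪k, par E t⟫ = ∑ i, m i * t i := by
    intro t
    simp_rw [← hm]
    simp only [par, PiLp.inner_apply, Finset.sum_mul]
    rw [Finset.sum_comm]
    refine Finset.sum_congr rfl fun j _ => ?_
    simp [dotProduct, Matrix.mulVec, Finset.sum_mul]
    refine Finset.sum_congr rfl fun j _ => ?_
    ring
  refine ⟨m, h2, ?_⟩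
  intro h0
  have := h2 (E⁻¹ *ᵥ k)
  rw [par_inv E hE, h0] at this
  simpa using this

/-- linear equivalence version of `par` -/
noncomputable def parL {d : ℕ} (E : Matrix (Fin d) (Fin d) ℝ) (hE : IsUnit E.det) :
    (Fin d → ℝ) ≃ₗ[ℝ] EuclideanSpace ℝ (Fin d) where
  toFun := par E
  invFun s := E⁻¹ *ᵥ s
  map_add' := par_add E
  map_smul' c s := by simp [par, Matrix.mulVec_smul]
  left_inv s := inv_par E hE s
  right_inv s := par_inv E hE s

lemma exists_basis {d : ℕ} (E : Matrix (Fin d) (Fin d) ℝ) (hE : IsUnit E.det) :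
    ∃ b : Module.Basis (Fin d) ℝ (EuclideanSpace ℝ (Fin d)),
      latticeSet E = (Submodule.span ℤ (Set.range b) : Set (EuclideanSpace ℝ (Fin d))) := by
  refine ⟨(Pi.basisFun ℝ (Fin d)).map (parL E hE), ?_⟩
  ext x
  rw [SetLike.mem_coe, Submodule.mem_span_range_iff_exists_fun]
  have key : ∀ c : Fin d → ℤ, ∑ i, c i • ((Pi.basisFun ℝ (Fin d)).map (parL E hE)) i
      = par E (fun j => (c j : ℝ)) := by
    intro c
    have : par E (fun j => (c j : ℝ)) = parL E hE (∑ i, c i • (Pi.basisFun ℝ (Fin d)) i) := by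
      refine congrArg (par E) ?_
      ext j
      simp [Finset.sum_apply, Pi.single_apply]
    rw [this, map_sum]
    refine Finset.sum_congr rfl fun i _ => ?_
    rw [map_zsmul]
    rfl
  simp_rw [key]
  rfl

lemma lat_finite {d : ℕ} (E : Matrix (Fin d) (Fin d) ℝ) (hE : IsUnit E.det) (r : ℝ) :
    (latticeSet E ∩ Metric.closedBall 0 r).Finite := by
  obtain ⟨b, hb⟩ := exists_basis E hE
  rw [hb, Set.inter_comm]
  exact ZSpan.setFinite_inter b Metric.isBounded_closedBall

/-- counting function -/
noncomputable def cnt {d : ℕ} (E : Matrix (Fin d) (Fin d) ℝ) (r : ℝ) : ℝ :=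
  (Nat.card ↥(latticeSet E ∩ Metric.closedBall 0 r) : ℝ)

lemma cnt_asymp {d : ℕ} (hd : d ≠ 0) (E : Matrix (Fin d) (Fin d) ℝ) (hE : IsUnit E.det) :
    ∃ C : ℝ, 0 < C ∧ Tendsto (fun r : ℝ => cnt E r / r ^ d) atTop (nhds C) := by
  obtain ⟨b, hb⟩ := exists_basis E hE
  have : NeZero d := ⟨hd⟩
  have : Nontrivial (EuclideanSpace ℝ (Fin d)) := by
    apply Module.nontrivial_of_finrank_pos (R := ℝ)
    simpa using Nat.pos_of_ne_zero hd
  let F : EuclideanSpace ℝ (Fin d) → ℝ := fun x => ‖x‖ ^ d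
  have hF : ∀ r : ℝ, 0 ≤ r → {x ∈ (Set.univ : Set (EuclideanSpace ℝ (Fin d))) | F x ≤ r ^ d} = Metric.closedBall 0 r := by
    intro r hr
    ext x
    simp [F, pow_le_pow_iff_left₀ (norm_nonneg x) hr hd]
  have hF1 : {x ∈ (Set.univ : Set (EuclideanSpace ℝ (Fin d))) | F x ≤ 1} = Metric.closedBall 0 1 := by
    rw [← hF 1 zero_le_one, one_pow]
  have := ZLattice.covolume.tendsto_card_le_div' (Submodule.span ℤ (Set.range b)) (X := Set.univ) (F := F)
    (fun _ _ _ _ => trivial)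
    (by intro x r hr; simp [F, norm_smul, mul_pow, abs_of_nonneg hr])
    (by rw [hF1]; exact Metric.isBounded_closedBall)
    (by rw [hF1]; exact measurableSet_closedBall)
    (by rw [hF1]; exact (convex_closedBall _ _).addHaar_frontier _)
  refine ⟨_, ?_, (this.comp (tendsto_pow_atTop hd)).congr' ?_⟩
  · rw [hF1]
    refine div_pos ?_ (ZLattice.covolume_pos _ _)
    exact ENNReal.toReal_pos (Metric.measure_closedBall_pos _ _ one_pos).ne' (isCompact_closedBall _ _).measure_ne_top
  · filter_upwards [eventually_ge_atTop 0] with r hr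
    simp only [Function.comp, cnt]
    rw [hF r hr, hb, Set.inter_comm]

lemma cnt_ratio {d : ℕ} (hd : d ≠ 0) (E : Matrix (Fin d) (Fin d) ℝ) (hE : IsUnit E.det) (ρ : ℝ) :
    Tendsto (fun r : ℝ => cnt E (r + ρ) / cnt E r) atTop (nhds 1) := by
  obtain ⟨C, hC, h⟩ := cnt_asymp hd E hE
  have h1 : Tendsto (fun r : ℝ => cnt E (r + ρ) / (r + ρ) ^ d) atTop (nhds C) :=
    h.comp (tendsto_atTop_add_const_right _ _ tendsto_id)
  have h2 : Tendsto (fun r : ℝ => ((r + ρ) / r) ^ d) atTop (nhds 1) := by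
    have : Tendsto (fun r : ℝ => 1 + ρ / r) atTop (nhds (1 + 0)) :=
      tendsto_const_nhds.add (tendsto_const_nhds.div_atTop tendsto_id)
    have := this.pow d
    rw [add_zero, one_pow] at this
    refine this.congr' ?_
    filter_upwards [eventually_gt_atTop 0] with r hr
    congr 1
    field_simp
  have h3 := (h1.div h hC.ne').mul h2
  rw [div_self hC.ne', one_mul] at h3
  refine h3.congr' ?_
  filter_upwards [eventually_gt_atTop 0, eventually_gt_atTop (-ρ)] with r hr hr'
  have : 0 < r + ρ := by linarith
  simp only [Pi.div_apply]
  rw [div_pow]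
  field_simp

/-- exponential -/
noncomputable def ee (x : ℝ) : ℂ := Complex.exp (2 * Real.pi * Complex.I * x)

lemma ee_add (x y : ℝ) : ee (x + y) = ee x * ee y := by
  simp [ee, mul_add, Complex.exp_add]

lemma ee_norm (x : ℝ) : ‖ee x‖ = 1 := by
  have : (2 * Real.pi * Complex.I * x : ℂ) = ((2 * Real.pi * x : ℝ) : ℂ) * Complex.I := by
    push_cast; ring
  rw [ee, this, Complex.norm_exp_ofReal_mul_I]

lemma ee_eq_one (x : ℝ) : ee x = 1 ↔ ∃ z : ℤ, x = z := by
  rw [ee, Complex.exp_eq_one_iff]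
  have hp : (2 * Real.pi * Complex.I : ℂ) ≠ 0 := by simp [Real.pi_ne_zero]
  refine exists_congr fun z => ?_
  constructor
  · intro h
    have : (2 * Real.pi * Complex.I : ℂ) * x = (2 * Real.pi * Complex.I) * z := by rw [h]; ring
    exact_mod_cast mul_left_cancel₀ hp this
  · rintro rfl
    push_cast
    ring

lemma ee_zero : ee 0 = 1 := by simp [ee]

/-- the finset of lattice points -/
noncomputable def LL {d : ℕ} (E : Matrix (Fin d) (Fin d) ℝ) (hE : IsUnit E.det) (r : ℝ) :
    Finset (EuclideanSpace ℝ (Fin d)) := (lat_finite E hE r).toFinset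

lemma mem_LL {d : ℕ} (E : Matrix (Fin d) (Fin d) ℝ) (hE : IsUnit E.det) (r : ℝ) (x) :
    x ∈ LL E hE r ↔ x ∈ latticeGroup E ∧ ‖x‖ ≤ r := by
  simp [LL, mem_latticeGroup]

lemma card_LL {d : ℕ} (E : Matrix (Fin d) (Fin d) ℝ) (hE : IsUnit E.det) (r : ℝ) :
    ((LL E hE r).card : ℝ) = cnt E r := by
  rw [cnt, LL, Nat.card_coe_set_eq, Set.ncard_eq_toFinset_card _ (lat_finite E hE r)]

lemma sum_diff_le {α : Type*} [DecidableEq α] (S T : Finset α) (h : S ⊆ T) (g : α → ℂ) (hg : ∀ x, ‖g x‖ = 1) :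
    ‖∑ x ∈ T, g x - ∑ x ∈ S, g x‖ ≤ T.card - S.card := by
  rw [← Finset.sum_sdiff h, add_sub_cancel_right]
  refine (norm_sum_le _ _).trans ?_
  simp only [hg, Finset.sum_const, nsmul_eq_mul, mul_one]
  rw [Finset.card_sdiff_of_subset h, Nat.cast_sub (Finset.card_le_card h)]

lemma exp_sum {d : ℕ} (E : Matrix (Fin d) (Fin d) ℝ) (hE : IsUnit E.det)
    (K : EuclideanSpace ℝ (Fin d)) (hK : K ∉ dualLattice E) :
    Tendsto (fun r => ((cnt E r : ℝ) : ℂ)⁻¹ * ∑ n ∈ LL E hE r, ee ⟪K, n⟫) atTop (nhds 0) := by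
  classical
  have hd : d ≠ 0 := by
    rintro rfl
    apply hK
    intro n _
    exact ⟨0, by rw [Subsingleton.elim n 0]; simp⟩
  obtain ⟨n₀, hn₀, hz⟩ : ∃ n ∈ latticeSet E, ¬ ∃ z : ℤ, ⟪K, n⟫ = (z : ℝ) := by
    by_contra! h
    exact hK h
  rw [← ee_eq_one] at hz
  set c := ee ⟪K, n₀⟫
  have hc : 0 < ‖c - 1‖ := norm_pos_iff.2 (sub_ne_zero.2 hz)
  have hn₀' := (mem_latticeGroup E n₀).2 hn₀
  have hb : ∀ r, ‖c - 1‖ * ‖∑ n ∈ LL E hE r, ee ⟪K, n⟫‖ ≤ 2 * (cnt E (r + ‖n₀‖) - cnt E r) := by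
    intro r
    have e1 : c * ∑ n ∈ LL E hE r, ee ⟪K, n⟫ = ∑ n ∈ (LL E hE r).map (addRightEmbedding n₀), ee ⟪K, n⟫ := by
      rw [Finset.sum_map, Finset.mul_sum]
      refine Finset.sum_congr rfl fun n _ => ?_
      simp [inner_add_right, ee_add, c, mul_comm]
    have s1 : (LL E hE r).map (addRightEmbedding n₀) ⊆ LL E hE (r + ‖n₀‖) := by
      intro x hx
      obtain ⟨y, hy, rfl⟩ := Finset.mem_map.1 hx
      rw [mem_LL] at hy ⊢
      exact ⟨add_mem hy.1 hn₀', (norm_add_le _ _).trans (by gcongr; exact hy.2)⟩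
    have s2 : LL E hE r ⊆ LL E hE (r + ‖n₀‖) := by
      intro x hx
      rw [mem_LL] at hx ⊢
      exact ⟨hx.1, hx.2.trans (by simp)⟩
    have b1 := sum_diff_le _ _ s1 (fun n => ee ⟪K, n⟫) (fun _ => ee_norm _)
    have b2 := sum_diff_le _ _ s2 (fun n => ee ⟪K, n⟫) (fun _ => ee_norm _)
    rw [Finset.card_map, card_LL, card_LL, ← e1] at b1
    rw [card_LL, card_LL] at b2
    rw [← norm_mul]
    set S := ∑ n ∈ LL E hE r, ee ⟪K, n⟫
    set T := ∑ n ∈ LL E hE (r + ‖n₀‖), ee ⟪K, n⟫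
    have : (c - 1) * S = (T - S) - (T - c * S) := by ring
    rw [this]
    refine (norm_sub_le _ _).trans ?_
    linarith
  have hlim : Tendsto (fun r => 2 * (cnt E (r + ‖n₀‖) / cnt E r - 1) / ‖c - 1‖) atTop (nhds 0) := by
    have := (((cnt_ratio hd E hE ‖n₀‖).sub_const 1).const_mul 2).div_const ‖c - 1‖
    simpa using this
  refine squeeze_zero_norm' ?_ hlim
  filter_upwards [eventually_ge_atTop 0] with r hr
  have hpos : 0 < cnt E r := by
    rw [← card_LL E hE, Nat.cast_pos, Finset.card_pos]
    exact ⟨0, (mem_LL _ _ _ _).2 ⟨zero_mem _, by simpa⟩⟩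
  rw [norm_mul, norm_inv, Complex.norm_real, Real.norm_of_nonneg hpos.le, le_div_iff₀ hc]
  have : 2 * (cnt E (r + ‖n₀‖) / cnt E r - 1) = (cnt E r)⁻¹ * (2 * (cnt E (r + ‖n₀‖) - cnt E r)) := by
    field_simp
  rw [this, mul_assoc]
  refine mul_le_mul_of_nonneg_left ?_ (inv_nonneg.2 hpos.le)
  rw [mul_comm]
  exact hb r

lemma quot_compact {d : ℕ} (E : Matrix (Fin d) (Fin d) ℝ) (hE : IsUnit E.det) :
    CompactSpace (QuotTorus E) := by
  constructor
  have h1 : IsCompact (Set.Icc (0 : Fin d → ℝ) 1) := isCompact_Icc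
  have hc : Continuous (fun t => (QuotientAddGroup.mk (par E t) : QuotTorus E)) :=
    continuous_quot_mk.comp (par_cont E)
  convert h1.image hc
  symm
  rw [Set.eq_univ_iff_forall]
  intro x
  obtain ⟨a, rfl⟩ := QuotientAddGroup.mk_surjective x
  set s : Fin d → ℝ := E⁻¹ *ᵥ a with hs
  refine ⟨fun i => Int.fract (s i), ⟨fun i => Int.fract_nonneg _, fun i => (Int.fract_lt_one _).le⟩, ?_⟩
  rw [QuotientAddGroup.eq, mem_latticeGroup]
  refine ⟨fun i => ⌊s i⌋, ?_⟩
  have : a = par E (fun i => Int.fract (s i)) + par E (fun i => (⌊s i⌋ : ℝ)) := by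
    rw [← par_add]
    have h2 : ((fun i => Int.fract (s i)) + fun i => (⌊s i⌋ : ℝ)) = s := by
      ext i; simp
    rw [h2, hs, par_inv E hE]
  exact eq_neg_add_of_add_eq this.symm

/-- being a character with frequency `k` -/
def IsChar {d p : ℕ} (G : Fin p → Matrix (Fin d) (Fin d) ℝ)
    (k : Fin p → EuclideanSpace ℝ (Fin d)) (g : C((j : Fin p) → QuotTorus (G j), ℂ)) : Prop :=
  (∀ j, k j ∈ dualLattice (G j)) ∧
    ∀ a : Fin p → EuclideanSpace ℝ (Fin d), g (fun j => QuotientAddGroup.mk (a j)) = ee (∑ j, ⟪k j, a j⟫)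

lemma dual_add {d : ℕ} (E : Matrix (Fin d) (Fin d) ℝ) {k l} (hk : k ∈ dualLattice E) (hl : l ∈ dualLattice E) :
    k + l ∈ dualLattice E := by
  intro n hn
  obtain ⟨z, hz⟩ := hk n hn
  obtain ⟨w, hw⟩ := hl n hn
  exact ⟨z + w, by rw [inner_add_left, hz, hw]; push_cast; rfl⟩

lemma dual_neg {d : ℕ} (E : Matrix (Fin d) (Fin d) ℝ) {k} (hk : k ∈ dualLattice E) :
    -k ∈ dualLattice E := by
  intro n hn
  obtain ⟨z, hz⟩ := hk n hn
  exact ⟨-z, by rw [inner_neg_left, hz]; push_cast; rfl⟩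

lemma dual_zero {d : ℕ} (E : Matrix (Fin d) (Fin d) ℝ) : 0 ∈ dualLattice E := by
  intro n hn
  exact ⟨0, by simp⟩

lemma ee_star (x : ℝ) : star (ee x) = ee (-x) := by
  rw [ee, ee, Complex.star_def, ← Complex.exp_conj]
  have : (starRingEnd ℂ) 2 = 2 := Complex.conj_ofNat 2
  simp [this]

lemma ee_cont : Continuous ee := by
  unfold ee
  fun_prop

lemma hull_surj {d p : ℕ} (G : Fin p → Matrix (Fin d) (Fin d) ℝ) (x : (j : Fin p) → QuotTorus (G j)) :
    ∃ a : Fin p → EuclideanSpace ℝ (Fin d), x = fun j => QuotientAddGroup.mk (a j) := by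
  choose a ha using fun j => QuotientAddGroup.mk_surjective (x j)
  exact ⟨a, funext fun j => (ha j).symm⟩

/-- character on a single torus -/
lemma exists_char {d : ℕ} (E : Matrix (Fin d) (Fin d) ℝ) {k} (hk : k ∈ dualLattice E) :
    ∃ g : C(QuotTorus E, ℂ), ∀ a : EuclideanSpace ℝ (Fin d), g (QuotientAddGroup.mk a) = ee ⟪k, a⟫ := by
  have hr : ∀ a b : EuclideanSpace ℝ (Fin d), (QuotientAddGroup.leftRel (latticeGroup E)) a b →
      ee ⟪k, a⟫ = ee ⟪k, b⟫ := by
    intro a b hab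
    rw [QuotientAddGroup.leftRel_apply, mem_latticeGroup] at hab
    have h1 : ee ⟪k, -a + b⟫ = 1 := (ee_eq_one _).2 (hk _ hab)
    have h2 : b = a + (-a + b) := by abel
    rw [h2, inner_add_right, ee_add, h1, mul_one]
  have hcont : Continuous (fun a : EuclideanSpace ℝ (Fin d) => ee ⟪k, a⟫) :=
    ee_cont.comp (by fun_prop)
  exact ⟨⟨fun x => Quotient.lift (fun a => ee ⟪k, a⟫) hr x, hcont.quotient_lift hr⟩, fun a => rfl⟩

lemma exists_sep {d : ℕ} (E : Matrix (Fin d) (Fin d) ℝ) (hE : IsUnit E.det)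
    (a b : EuclideanSpace ℝ (Fin d)) (h : (QuotientAddGroup.mk a : QuotTorus E) ≠ QuotientAddGroup.mk b) :
    ∃ k ∈ dualLattice E, ee ⟪k, a⟫ ≠ ee ⟪k, b⟫ := by
  by_contra! hcon
  apply h
  rw [QuotientAddGroup.eq, mem_latticeGroup]
  have h1 : ∀ i, ∃ z : ℤ, (E⁻¹ *ᵥ (-a + b : EuclideanSpace ℝ (Fin d))) i = z := by
    intro i
    have hin : ∀ x : EuclideanSpace ℝ (Fin d), ⟪WithLp.toLp 2 (E⁻¹ i), x⟫ = (E⁻¹ *ᵥ x) i := by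
      intro x
      simp [PiLp.inner_apply, Matrix.mulVec, dotProduct, mul_comm]
    have hk : WithLp.toLp 2 (E⁻¹ i) ∈ dualLattice E := by
      rintro _ ⟨m, rfl⟩
      refine ⟨m i, ?_⟩
      rw [hin]
      exact congrFun (inv_par E hE _) i
    have := hcon _ hk
    rw [← hin, ← ee_eq_one, inner_add_right, ee_add, ← this, ← ee_add, inner_neg_right, neg_add_cancel, ee_zero]
  choose m hm using h1
  refine ⟨m, ?_⟩
  have h2 := par_inv E hE (-a + b)
  rw [← h2]
  refine congrArg (par E) ?_
  ext i
  exact (hm i).symm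

/-- the characters -/
def charSet {d p : ℕ} (G : Fin p → Matrix (Fin d) (Fin d) ℝ) :
    Set C((j : Fin p) → QuotTorus (G j), ℂ) := {g | ∃ k, IsChar G k g}

lemma charSet_dense {d p : ℕ} (G : Fin p → Matrix (Fin d) (Fin d) ℝ) (hG : ∀ j, IsUnit (G j).det)
    [CompactSpace ((j : Fin p) → QuotTorus (G j))] (f : C((j : Fin p) → QuotTorus (G j), ℂ)) :
    f ∈ closure (Submodule.span ℂ (charSet G) : Set C((j : Fin p) → QuotTorus (G j), ℂ)) := by
  classical
  let A : StarSubalgebra ℂ C((j : Fin p) → QuotTorus (G j), ℂ) :=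
    { toSubalgebra := Algebra.adjoin ℂ (charSet G)
      star_mem' := by
        change Algebra.adjoin ℂ (charSet G) ≤ star (Algebra.adjoin ℂ (charSet G))
        refine Algebra.adjoin_le ?_
        rintro g ⟨k, hk, hg⟩
        refine Algebra.subset_adjoin ⟨-k, fun j => dual_neg _ (hk j), fun a => ?_⟩
        change star (g _) = _
        rw [hg, ee_star]
        simp }
  have hA : Subalgebra.toSubmodule A.toSubalgebra = Submodule.span ℂ (charSet G) := by
    apply Algebra.adjoin_eq_span_of_subset
    refine Set.Subset.trans ?_ Submodule.subset_span
    intro x hx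
    refine Submonoid.closure_induction (fun _ h => h) ?_ ?_ hx
    · exact ⟨0, fun j => dual_zero _, fun a => by simp [ee_zero]⟩
    · rintro g h - - ⟨k, hk, hg⟩ ⟨l, hl, hh⟩
      refine ⟨k + l, fun j => dual_add _ (hk j) (hl j), fun a => ?_⟩
      simp [hg, hh, inner_add_left, Finset.sum_add_distrib, ee_add]
  have hsep : A.SeparatesPoints := by
    intro x y hxy
    obtain ⟨a, rfl⟩ := hull_surj G x
    obtain ⟨b, rfl⟩ := hull_surj G y
    obtain ⟨j, hj⟩ := Function.ne_iff.1 hxy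
    obtain ⟨k, hk, hne⟩ := exists_sep (G j) (hG j) _ _ hj
    obtain ⟨g, hg⟩ := exists_char (G j) hk
    let g' : C((j : Fin p) → QuotTorus (G j), ℂ) := g.comp ⟨fun x => x j, continuous_apply j⟩
    refine ⟨g', ⟨g', ?_, rfl⟩, ?_⟩
    · refine Algebra.subset_adjoin ⟨Pi.single j k, ?_, ?_⟩
      · intro i
        by_cases h : i = j
        · subst h; simpa using hk
        · simpa [h] using dual_zero _
      · intro a
        change g (QuotientAddGroup.mk (a j)) = _
        rw [hg, Finset.sum_eq_single j]
        · simp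
        · intro i _ h; simp [h]
        · simp
    · change g (QuotientAddGroup.mk (a j)) ≠ g (QuotientAddGroup.mk (b j))
      rw [hg, hg]
      exact hne
  have := ContinuousMap.starSubalgebra_topologicalClosure_eq_top_of_separatesPoints A hsep
  have hf : f ∈ A.topologicalClosure := by rw [this]; trivial
  rw [← hA]
  exact hf

lemma int_char {d p : ℕ} (G : Fin p → Matrix (Fin d) (Fin d) ℝ) (hG : ∀ j, IsUnit (G j).det)
    (k : Fin p → EuclideanSpace ℝ (Fin d)) (g : C((j : Fin p) → QuotTorus (G j), ℂ)) (hg : IsChar G k g) :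
    ∫ x, g x ∂(Measure.pi fun j => haarProb (G j)) = if k = 0 then 1 else 0 := by
  classical
  have : ∀ j, OpensMeasurableSpace (QuotTorus (G j)) := fun j => quot_meas _
  obtain ⟨hk, hg⟩ := hg
  simp_rw [fun j => haarProb_eq (G j) (hG j)]
  rw [← Measure.pi_map_pi (fun j => (par_mk_meas (G j)).aemeasurable), integral_map]
  · choose m hm hm0 using fun j => dual_par (G j) (hG j) (k j) (hk j)
    have h1 : ∀ t : Fin p → Fin d → ℝ, g (fun j => QuotientAddGroup.mk (par (G j) (t j)))
      = ∏ j, Complex.exp (2 * Real.pi * Complex.I * ∑ i, (m j i * t j i : ℂ)) := by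
      intro t
      rw [hg (fun j => par (G j) (t j)), ← Complex.exp_sum, ee]
      congr 1
      push_cast [hm]
      rw [Finset.mul_sum]
    simp_rw [h1]
    rw [integral_fintype_prod_eq_prod (fun j (t : Fin d → ℝ) =>
      Complex.exp (2 * Real.pi * Complex.I * ∑ i, (m j i * t i : ℂ)))]
    simp_rw [int_cube]
    split_ifs with h
    · refine Finset.prod_eq_one fun j _ => ?_
      rw [if_pos]
      ext i
      have := hm j (Pi.single i 1)
      simp only [h, Pi.zero_apply, inner_zero_left, Pi.single_apply, mul_ite, mul_one, mul_zero,
        Finset.sum_ite_eq', Finset.mem_univ, if_true] at this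
      simpa using this.symm
    · obtain ⟨j, hj⟩ := Function.ne_iff.1 h
      refine Finset.prod_eq_zero (Finset.mem_univ j) ?_
      rw [if_neg]
      intro h0
      exact hj (hm0 j h0)
  · exact (measurable_pi_lambda _ fun j => (par_mk_meas (G j)).comp (measurable_pi_apply j)).aemeasurable
  · exact g.continuous.measurable.aestronglyMeasurable

lemma cnt_pos {d : ℕ} (E : Matrix (Fin d) (Fin d) ℝ) (hE : IsUnit E.det) {r : ℝ} (hr : 0 ≤ r) : 0 < cnt E r := by
  rw [← card_LL E hE, Nat.cast_pos, Finset.card_pos]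
  exact ⟨0, (mem_LL _ _ _ _).2 ⟨zero_mem _, by simpa⟩⟩

/-- averages -/
noncomputable def avg {d p : ℕ} (E : Fin (p + 1) → Matrix (Fin d) (Fin d) ℝ)
    (hE : ∀ j, IsUnit (E j).det) (γ : (j : Fin p) → QuotTorus (E j.succ))
    (f : ((j : Fin p) → QuotTorus (E j.succ)) → ℂ) (r : ℝ) : ℂ :=
  ((cnt (E 0) r : ℝ) : ℂ)⁻¹ * ∑ n ∈ LL (E 0) (hE 0) r, f (fun j => γ j - QuotientAddGroup.mk n)

lemma avg_char {d p : ℕ} (E : Fin (p + 1) → Matrix (Fin d) (Fin d) ℝ)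
    (hE : ∀ j, IsUnit (E j).det) (hinc : Incommensurate E) (γ : (j : Fin p) → QuotTorus (E j.succ))
    (k : Fin p → EuclideanSpace ℝ (Fin d))
    (g : C((j : Fin p) → QuotTorus (E j.succ), ℂ)) (hg : IsChar (fun j => E j.succ) k g) :
    Tendsto (avg E hE γ g) atTop (nhds (∫ x, g x ∂(Measure.pi fun j : Fin p => haarProb (E j.succ)))) := by
  rw [int_char (fun j => E j.succ) (fun j => hE j.succ) k g hg]
  obtain ⟨a, rfl⟩ := hull_surj _ γ
  have h1 : ∀ n : EuclideanSpace ℝ (Fin d), g (fun j => (QuotientAddGroup.mk (a j) : QuotTorus (E j.succ)) - QuotientAddGroup.mk n)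
      = ee (∑ j, ⟪k j, a j⟫) * ee ⟪-∑ j, k j, n⟫ := by
    intro n
    refine (hg.2 (fun j => a j - n)).trans ?_
    rw [← ee_add]
    congr 1
    simp only [inner_sub_right, inner_neg_left, sum_inner, Finset.sum_sub_distrib]
    ring
  have h2 : avg E hE (fun j => QuotientAddGroup.mk (a j)) g = fun r =>
      ee (∑ j, ⟪k j, a j⟫) * (((cnt (E 0) r : ℝ) : ℂ)⁻¹ * ∑ n ∈ LL (E 0) (hE 0) r, ee ⟪-∑ j, k j, n⟫) := by
    ext r
    simp only [avg, h1, ← Finset.mul_sum]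
    ring
  rw [h2]
  split_ifs with h
  · subst h
    refine tendsto_const_nhds.congr' ?_
    filter_upwards [eventually_ge_atTop 0] with r hr
    have h3 := cnt_pos (E 0) (hE 0) hr
    have h4 : ((LL (E 0) (hE 0) r).card : ℂ) = ((cnt (E 0) r : ℝ) : ℂ) := by
      rw [← card_LL _ (hE 0)]; simp
    have h5 : ((cnt (E 0) r : ℝ) : ℂ) ≠ 0 := by exact_mod_cast h3.ne'
    simp [ee_zero, h4, h5]
  · have hK : -∑ j, k j ∉ dualLattice (E 0) := by
      intro hK
      have := hinc (Fin.cons (-∑ j, k j) k) (by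
        intro j
        refine Fin.cases ?_ (fun i => ?_) j
        · simpa using hK
        · simpa using hg.1 i)
      rw [Fin.sum_univ_succ] at this
      simp only [Fin.cons_zero, Fin.cons_succ, neg_add_cancel, true_iff] at this
      exact h (funext fun j => by simpa using this j.succ)
    simpa using (exp_sum (E 0) (hE 0) _ hK).const_mul (ee (∑ j, ⟪k j, a j⟫))

lemma avg_tendsto {d p : ℕ} (E : Fin (p + 1) → Matrix (Fin d) (Fin d) ℝ)
    (hE : ∀ j, IsUnit (E j).det) (hinc : Incommensurate E) (γ : (j : Fin p) → QuotTorus (E j.succ))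
    (f : C((j : Fin p) → QuotTorus (E j.succ), ℂ)) :
    Tendsto (avg E hE γ f) atTop (nhds (∫ x, f x ∂(Measure.pi fun j : Fin p => haarProb (E j.succ)))) := by
  have : ∀ j : Fin p, OpensMeasurableSpace (QuotTorus (E j.succ)) := fun j => quot_meas _
  have : ∀ j : Fin p, CompactSpace (QuotTorus (E j.succ)) := fun j => quot_compact _ (hE _)
  have : ∀ j : Fin p, IsProbabilityMeasure (haarProb (E j.succ)) := fun j => haarProb_prob _ (hE _)
  set μ := Measure.pi fun j : Fin p => haarProb (E j.succ) with hμ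
  have hint : ∀ g : C((j : Fin p) → QuotTorus (E j.succ), ℂ), Integrable g μ := by
    intro g
    refine Integrable.of_bound g.continuous.measurable.aestronglyMeasurable ‖g‖ ?_
    exact Eventually.of_forall fun x => g.norm_coe_le_norm x
  have hspan : ∀ g ∈ Submodule.span ℂ (charSet fun j : Fin p => E j.succ),
      Tendsto (avg E hE γ g) atTop (nhds (∫ x, g x ∂μ)) := by
    intro g hg
    induction hg using Submodule.span_induction with
    | mem g hg =>
      obtain ⟨k, hk⟩ := hg
      exact avg_char E hE hinc γ k g hk
    | zero =>
      have : avg E hE γ (0 : C((j : Fin p) → QuotTorus (E j.succ), ℂ)) = fun _ => 0 := by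
        ext r; simp [avg]
      rw [this]
      simp
    | add g h _ _ hg hh =>
      have : avg E hE γ (g + h : C((j : Fin p) → QuotTorus (E j.succ), ℂ)) = fun r => avg E hE γ g r + avg E hE γ h r := by
        ext r; simp [avg, Finset.sum_add_distrib, mul_add]
      rw [this]
      have h2 : ∫ x, (g + h) x ∂μ = ∫ x, g x ∂μ + ∫ x, h x ∂μ := integral_add (hint g) (hint h)
      rw [h2]
      exact hg.add hh
    | smul c g _ hg =>
      have : avg E hE γ (c • g : C((j : Fin p) → QuotTorus (E j.succ), ℂ)) = fun r => c * avg E hE γ g r := by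
        ext r; simp [avg, ← Finset.mul_sum]; ring
      rw [this]
      have h2 : ∫ x, (c • g) x ∂μ = c * ∫ x, g x ∂μ := integral_const_mul c _
      rw [h2]
      exact hg.const_mul c
  rw [Metric.tendsto_atTop']
  intro ε hε
  obtain ⟨g, hg, hfg⟩ := Metric.mem_closure_iff.1
    (charSet_dense (fun j : Fin p => E j.succ) (fun j => hE _) f) (ε / 3) (by positivity)
  obtain ⟨N, hN⟩ := Metric.tendsto_atTop'.1 (hspan g hg) (ε / 3) (by positivity)
  have hpt : ∀ x, ‖f x - g x‖ ≤ ε / 3 := by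
    intro x
    rw [← dist_eq_norm]
    exact (ContinuousMap.dist_apply_le_dist x).trans hfg.le
  refine ⟨max N 0, fun r hr => ?_⟩
  have hN := hN r (lt_of_le_of_lt (le_max_left _ _) hr)
  have hr0 : 0 ≤ r := (lt_of_le_of_lt (le_max_right _ _) hr).le
  have hpos := cnt_pos (E 0) (hE 0) hr0
  have b1 : dist (avg E hE γ f r) (avg E hE γ g r) ≤ ε / 3 := by
    rw [dist_eq_norm, avg, avg, ← mul_sub, ← Finset.sum_sub_distrib, norm_mul, norm_inv,
      Complex.norm_real, Real.norm_of_nonneg hpos.le, inv_mul_le_iff₀ hpos]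
    refine (norm_sum_le_of_le _ (fun n _ => hpt _)).trans ?_
    rw [Finset.sum_const, nsmul_eq_mul, card_LL]
  have b2 : dist (∫ x, g x ∂μ) (∫ x, f x ∂μ) ≤ ε / 3 := by
    rw [dist_comm, dist_eq_norm, ← integral_sub (hint f) (hint g)]
    refine (norm_integral_le_of_norm_le_const (Eventually.of_forall hpt)).trans ?_
    simp
  calc _ ≤ dist (avg E hE γ f r) (avg E hE γ g r) + dist (avg E hE γ g r) (∫ x, g x ∂μ)
        + dist (∫ x, g x ∂μ) (∫ x, f x ∂μ) := dist_triangle4 _ _ _ _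
    _ < ε := by linarith

/-- Discrete equidistribution: for incommensurate lattices `R_1, …, R_{p+1}` (with `R_1`
indexed by `0`), the `R_1`-orbit of any point of `Γ_2 × ⋯ × Γ_{p+1}` equidistributes with
respect to the product of the normalized Haar measures. -/
theorem stmt12 {d p : ℕ} (E : Fin (p + 1) → Matrix (Fin d) (Fin d) ℝ)
    (hE : ∀ j, IsUnit (E j).det) (hinc : Incommensurate E)
    (f : ((j : Fin p) → QuotTorus (E j.succ)) → ℂ) (hf : Continuous f)
    (γ : (j : Fin p) → QuotTorus (E j.succ)) :
    Tendsto
      (fun r : ℝ =>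
        ((Nat.card ↥(latticeSet (E 0) ∩ Metric.closedBall 0 r) : ℂ))⁻¹ *
          ∑' n : ↥(latticeSet (E 0) ∩ Metric.closedBall 0 r),
            f (fun j => γ j - QuotientAddGroup.mk (n : EuclideanSpace ℝ (Fin d))))
      atTop
      (nhds (∫ x, f x ∂(Measure.pi fun j : Fin p => haarProb (E j.succ)))) := by
  refine (avg_tendsto E hE hinc γ ⟨f, hf⟩).congr fun r => ?_
  have hfin := lat_finite (E 0) (hE 0) r
  have := hfin.fintype
  rw [avg, cnt, Complex.ofReal_natCast]
  congr 1
  rw [tsum_fintype]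
  have h := Finset.sum_coe_sort (LL (E 0) (hE 0) r)
    (fun n => f (fun j => γ j - QuotientAddGroup.mk n))
  refine Finset.sum_subtype _ (fun x => ?_) _
  simp [LL]
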